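/- Fix an action b ∈ A. The partial failure trace preorder is fully abstract w.r.t. the operators of CCSP^g_t and the canonical safety property: for all processes P and Q, fft(P) ⊇ fft(Q) if and only if for every unary recursion-free CCSP^g_t-context C, C[P] ⊨ safety(b) implies C[Q] ⊨ safety(b). -/

import Mathlib

/-! ### The process algebras CCSP_t and CCSP^g_t

The countably infinite set `A` of visible actions and the countably infinite set `V`
of variables are both taken to be `ℕ`.  Besides the operators of CCSP_t, the syntax
below also provides guarded sums `Σ_{i=1}^n αᵢ.Eᵢ` with `n ∈ ℕ ∪ {∞}` (represented
as partial functions `ℕ → Option (Act × Expr)`); the CCSP^g_t expressions are those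
not containing the binary choice `+`. -/

/-- Actions: visible actions from `A = ℕ`, the hidden action `τ`,
and the time-out action `t`. -/
inductive Act : Type
  | act : ℕ → Act
  | tau : Act
  | timeout : Act

/-- CCSP_t expressions.  A recursive specification `S` is represented as a partial
function `ℕ → Option Expr`; its domain is the set `V_S` of bound variables, and
`⟨X|S⟩` is written `Expr.fix X S`. -/
inductive Expr : Type
  | nil : Expr
  | pre : Act → Expr → Expr
  | choice : Expr → Expr → Expr
  | par : Set ℕ → Expr → Expr → Expr
  | abs : Set ℕ → Expr → Expr
  | ren : Set (ℕ × ℕ) → Expr → Expr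
  | var : ℕ → Expr
  | fix : ℕ → (ℕ → Option Expr) → Expr
  | gsum : (ℕ → Option (Act × Expr)) → Expr

/-- `α.notIn S`: the action `α` is not a visible action belonging to `S ⊆ A`. -/
def Act.notIn (α : Act) (S : Set ℕ) : Prop := ∀ a : ℕ, α = Act.act a → a ∉ S

/-- Relational substitution: `Subst ρ E E'` holds iff `E'` is the result of replacing,
in `E`, every free occurrence of each variable `Y` in the domain of `ρ` by the
expression `ρ Y` (occurrences bound by an inner recursion are not replaced). -/
inductive Subst : (ℕ → Option Expr) → Expr → Expr → Prop
  | nil {ρ} : Subst ρ .nil .nil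
  | pre {ρ α E E'} : Subst ρ E E' → Subst ρ (.pre α E) (.pre α E')
  | choice {ρ E F E' F'} : Subst ρ E E' → Subst ρ F F' →
      Subst ρ (.choice E F) (.choice E' F')
  | par {ρ S E F E' F'} : Subst ρ E E' → Subst ρ F F' →
      Subst ρ (.par S E F) (.par S E' F')
  | abs {ρ I E E'} : Subst ρ E E' → Subst ρ (.abs I E) (.abs I E')
  | ren {ρ R E E'} : Subst ρ E E' → Subst ρ (.ren R E) (.ren R E')
  | varNone {ρ Y} : ρ Y = none → Subst ρ (.var Y) (.var Y)
  | varSome {ρ Y F} : ρ Y = some F → Subst ρ (.var Y) F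
  | gsum {ρ} {f f' : ℕ → Option (Act × Expr)} :
      (∀ i, f i = none ↔ f' i = none) →
      (∀ i α E α' E', f i = some (α, E) → f' i = some (α', E') → α' = α) →
      (∀ i α E α' E', f i = some (α, E) → f' i = some (α', E') → Subst ρ E E') →
      Subst ρ (.gsum f) (.gsum f')
  | fix {ρ Z} {T T' : ℕ → Option Expr} :
      (∀ Y, T Y = none ↔ T' Y = none) →
      (∀ Y E E', T Y = some E → T' Y = some E' →
          Subst (fun W => if (T W).isSome then none else ρ W) E E') →
      Subst ρ (.fix Z T) (.fix Z T')

/-- The substitution replacing each bound variable `Y` of `S` by `⟨Y|S⟩`. -/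
def recmap (S : ℕ → Option Expr) : ℕ → Option Expr :=
  fun Y => (S Y).map (fun _ => Expr.fix Y S)

/-- The structural operational (interleaving) semantics of CCSP_t. -/
inductive Step : Expr → Act → Expr → Prop
  | pre {α E} : Step (.pre α E) α E
  | choiceL {E F α E'} : Step E α E' → Step (.choice E F) α E'
  | choiceR {E F α F'} : Step F α F' → Step (.choice E F) α F'
  | renTau {R E E'} : Step E .tau E' → Step (.ren R E) .tau (.ren R E')
  | renTimeout {R E E'} : Step E .timeout E' →
      Step (.ren R E) .timeout (.ren R E')
  | renAct {R E E' a b} : Step E (.act a) E' → (a, b) ∈ R →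
      Step (.ren R E) (.act b) (.ren R E')
  | parL {S E F α E'} : Step E α E' → α.notIn S →
      Step (.par S E F) α (.par S E' F)
  | parR {S E F α F'} : Step F α F' → α.notIn S →
      Step (.par S E F) α (.par S E F')
  | parSync {S E F a E' F'} : Step E (.act a) E' → Step F (.act a) F' → a ∈ S →
      Step (.par S E F) (.act a) (.par S E' F')
  | absFree {I E α E'} : Step E α E' → α.notIn I →
      Step (.abs I E) α (.abs I E')
  | absHide {I E a E'} : Step E (.act a) E' → a ∈ I →
      Step (.abs I E) .tau (.abs I E')
  | fixUnfold {X S E E' α F} : S X = some E → Subst (recmap S) E E' →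
      Step E' α F → Step (.fix X S) α F
  | gsum {f : ℕ → Option (Act × Expr)} {i α E} : f i = some (α, E) →
      Step (.gsum f) α E

/-- Free occurrence of a variable in a CCSP_t expression. -/
inductive Free (x : ℕ) : Expr → Prop
  | pre {α E} : Free x E → Free x (.pre α E)
  | choiceL {E F} : Free x E → Free x (.choice E F)
  | choiceR {E F} : Free x F → Free x (.choice E F)
  | parL {S E F} : Free x E → Free x (.par S E F)
  | parR {S E F} : Free x F → Free x (.par S E F)
  | abs {I E} : Free x E → Free x (.abs I E)
  | ren {R E} : Free x E → Free x (.ren R E)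
  | var : Free x (.var x)
  | fix {Z T Y E} : T Y = some E → Free x E → T x = none → Free x (.fix Z T)
  | gsum {f : ℕ → Option (Act × Expr)} {i α E} : f i = some (α, E) → Free x E →
      Free x (.gsum f)

/-- An expression is closed if no variable occurs free in it. -/
def Closed (E : Expr) : Prop := ∀ x, ¬ Free x E

/-- Well-formedness: in every recursion `⟨X|S⟩` occurring in the expression the
variable `X` is bound by `S`, and every relational renaming occurring in it has
finite images `{b | (a,b) ∈ R}`. -/
inductive WF : Expr → Prop
  | nil : WF .nil
  | pre {α E} : WF E → WF (.pre α E)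
  | choice {E F} : WF E → WF F → WF (.choice E F)
  | par {S E F} : WF E → WF F → WF (.par S E F)
  | abs {I E} : WF E → WF (.abs I E)
  | ren {R E} : (∀ a : ℕ, {b | (a, b) ∈ R}.Finite) → WF E → WF (.ren R E)
  | var {X} : WF (.var X)
  | fix {X T} : (T X).isSome → (∀ Y E, T Y = some E → WF E) → WF (.fix X T)
  | gsum {f : ℕ → Option (Act × Expr)} : (∀ i α E, f i = some (α, E) → WF E) →
      WF (.gsum f)

/-- `ℙ`: a process is a closed well-formed CCSP_t expression. -/
def IsProcess (E : Expr) : Prop := Closed E ∧ WF E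

/-- A process is stable if it has no outgoing τ-transitions. -/
def stable (P : Expr) : Prop := ¬ ∃ P', Step P .tau P'

/-- The set `I(P)` of initial visible actions of a process. -/
def initials (P : Expr) : Set ℕ := {a | ∃ P', Step P (.act a) P'}

/-- CCSP^g_t expressions: the binary choice operator `+` does not occur. -/
inductive NoPlus : Expr → Prop
  | nil : NoPlus .nil
  | pre {α E} : NoPlus E → NoPlus (.pre α E)
  | par {S E F} : NoPlus E → NoPlus F → NoPlus (.par S E F)
  | abs {I E} : NoPlus E → NoPlus (.abs I E)
  | ren {R E} : NoPlus E → NoPlus (.ren R E)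
  | var {X} : NoPlus (.var X)
  | fix {Z T} : (∀ Y E, T Y = some E → NoPlus E) → NoPlus (.fix Z T)
  | gsum {f : ℕ → Option (Act × Expr)} : (∀ i α E, f i = some (α, E) → NoPlus E) →
      NoPlus (.gsum f)

/-! ### Partial failure traces -/

/-- An element of a partial failure trace: a visible action `a ∈ A`
or a refusal set `X ⊆ A`. -/
abbrev Elt : Type := Sum ℕ (Set ℕ)

/-- Partial failure traces: sequences over `A ∪ 𝒫(A)`; the final tag `⊤` is
left implicit. -/
abbrev PFT : Type := List Elt

/-- The set of partial failure traces of a process (Table 3). -/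
inductive fft : Expr → PFT → Prop
  | top {P} : fft P []
  | act {P Q a ρ} : Step P (.act a) Q → fft Q ρ → fft P (Sum.inl a :: ρ)
  | tau {P Q ρ} : Step P .tau Q → fft Q ρ → fft P ρ
  | refusal {P X ρ} : (∀ a ∈ X, a ∉ initials P) → stable P → fft P ρ →
      fft P (Sum.inr X :: ρ)
  | timeoutRef {P Q X ρ} : (∀ a ∈ X, a ∉ initials P) → stable P →
      Step P .timeout Q → fft Q (Sum.inr X :: ρ) → fft P (Sum.inr X :: ρ)
  | timeoutAct {P Q X a ρ} : (∀ a' ∈ X, a' ∉ initials P) → stable P →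
      Step P .timeout Q → fft Q (Sum.inl a :: ρ) → a ∈ X →
      fft P (Sum.inr X :: Sum.inl a :: ρ)

def fftSet (P : Expr) : Set PFT := {σ | fft P σ}

/-! ### Unary recursion-free CCSP^g_t-contexts -/

/-- Unary recursion-free CCSP^g_t-contexts: expressions built from a hole and the
operators guarded sum, `∥_S`, `τ_I` and renaming of CCSP^g_t, with expressions as
further arguments.  In `GCtx.gsum f α C` the hole occurs in the summand `α.C`,
next to the further summands given by `f`. -/
inductive GCtx : Type
  | hole : GCtx
  | gsum : (ℕ → Option (Act × Expr)) → Act → GCtx → GCtx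
  | parL : Set ℕ → GCtx → Expr → GCtx
  | parR : Set ℕ → Expr → GCtx → GCtx
  | abs : Set ℕ → GCtx → GCtx
  | ren : Set (ℕ × ℕ) → GCtx → GCtx

/-- `C.fill P = C[P]`: the process obtained by filling the hole with `P`. -/
def GCtx.fill : GCtx → Expr → Expr
  | .hole, P => P
  | .gsum f α C, P => .gsum (fun i => Nat.casesOn i (some (α, C.fill P)) f)
  | .parL S C Q, P => .par S (C.fill P) Q
  | .parR S Q C, P => .par S Q (C.fill P)
  | .abs I C, P => .abs I (C.fill P)
  | .ren R C, P => .ren R (C.fill P)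

/-- The further arguments of the context are closed CCSP^g_t processes, and all
renaming operators in the context have finite images. -/
inductive GCtx.OK : GCtx → Prop
  | hole : GCtx.OK .hole
  | gsum {f : ℕ → Option (Act × Expr)} {α C} :
      (∀ i β E, f i = some (β, E) → IsProcess E ∧ NoPlus E) → GCtx.OK C →
      GCtx.OK (.gsum f α C)
  | parL {S C Q} : GCtx.OK C → IsProcess Q → NoPlus Q → GCtx.OK (.parL S C Q)
  | parR {S Q C} : IsProcess Q → NoPlus Q → GCtx.OK C → GCtx.OK (.parR S Q C)
  | abs {I C} : GCtx.OK C → GCtx.OK (.abs I C)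
  | ren {R C} : (∀ a : ℕ, {b | (a, b) ∈ R}.Finite) → GCtx.OK C → GCtx.OK (.ren R C)

/-! ### Safety and freshness -/

/-- Reachability via the transition relation. -/
inductive Reach : Expr → Expr → Prop
  | refl (P) : Reach P P
  | step {P α Q R} : Step P α Q → Reach Q R → Reach P R

/-- The action `b` is fresh for the process `P`: no process reachable from `P`
has an outgoing `b`-transition. -/
def FreshFor (b : ℕ) (P : Expr) : Prop :=
  ∀ R, Reach P R → ∀ R', ¬ Step R (.act b) R'

/-- The action `b` is fresh for the partial failure trace `σ`: it occurs in `σ`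
neither as an action nor inside a refusal set. -/
def FreshTrace (b : ℕ) (σ : PFT) : Prop :=
  Sum.inl b ∉ σ ∧ ∀ X : Set ℕ, Sum.inr X ∈ σ → b ∉ X

/-- The canonical safety property: `P ⊨ safety(b)` iff no partial failure trace
of `P` contains the action `b`. -/
def Safety (b : ℕ) (P : Expr) : Prop := ∀ σ, fft P σ → Sum.inl b ∉ σ

/-! ### Precongruence -/

/-- A unary operator family `op`, indexed by states, whose argument is never duplicated or
discarded: the state may move on its own (`alone`), or a visible action of the argument is
turned into another action (`comb`), and hidden actions and time-outs of the argument are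
passed on unchanged. -/
structure LinearOp {St : Type} (op : St → Expr → Expr) where
  alone : St → Act → St → Prop
  comb : St → ℕ → Act → St → Prop
  comb_timeout : ∀ s a s', ¬ comb s a .timeout s'
  step_iff : ∀ s x α z, Step (op s x) α z ↔
    (∃ s', alone s α s' ∧ z = op s' x) ∨
    (∃ a x' s', Step x (.act a) x' ∧ comb s a α s' ∧ z = op s' x') ∨
    ((α = .tau ∨ α = .timeout) ∧ ∃ x', Step x α x' ∧ z = op s x')

namespace LinearOp

variable {St : Type} {op : St → Expr → Expr} (L : LinearOp op)

/-- The visible actions the argument must refuse in state `s` for `X` to be refused stably. -/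
def refSet (s : St) (X : Set ℕ) : Set ℕ :=
  {a | ∃ s', L.comb s a .tau s' ∨ ∃ c ∈ X, L.comb s a (.act c) s'}

/-- The state `s` on its own is stable and refuses `X`. -/
def Quiet (s : St) (X : Set ℕ) : Prop :=
  (∀ s', ¬ L.alone s .tau s') ∧ ∀ c ∈ X, ∀ s', ¬ L.alone s (.act c) s'

lemma stable_refuses_iff (s : St) (X : Set ℕ) (x : Expr) :
    (stable (op s x) ∧ ∀ c ∈ X, c ∉ initials (op s x)) ↔
      L.Quiet s X ∧ stable x ∧ ∀ a ∈ L.refSet s X, a ∉ initials x := by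
  constructor
  · rintro ⟨h1, h2⟩
    refine ⟨⟨fun s' h => h1 ⟨_, (L.step_iff _ _ _ _).2 (.inl ⟨s', h, rfl⟩)⟩,
      fun c hc s' h => h2 c hc ⟨_, (L.step_iff _ _ _ _).2 (.inl ⟨s', h, rfl⟩)⟩⟩,
      fun ⟨x', h⟩ => h1 ⟨_, (L.step_iff _ _ _ _).2 (.inr (.inr ⟨.inl rfl, x', h, rfl⟩))⟩, ?_⟩
    rintro a ⟨s', h | ⟨c, hc, h⟩⟩ ⟨x', hx⟩
    · exact h1 ⟨_, (L.step_iff _ _ _ _).2 (.inr (.inl ⟨a, x', s', hx, h, rfl⟩))⟩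
    · exact h2 c hc ⟨_, (L.step_iff _ _ _ _).2 (.inr (.inl ⟨a, x', s', hx, h, rfl⟩))⟩
  · rintro ⟨⟨h1, h2⟩, h3, h4⟩
    constructor
    · rintro ⟨z, hz⟩
      rcases (L.step_iff _ _ _ _).1 hz with ⟨s', h, -⟩ | ⟨a, x', s', hx, h, -⟩ | ⟨-, x', h, -⟩
      · exact h1 _ h
      · exact h4 a ⟨s', .inl h⟩ ⟨x', hx⟩
      · exact h3 ⟨x', h⟩
    · rintro c hc ⟨z, hz⟩
      rcases (L.step_iff _ _ _ _).1 hz with ⟨s', h, -⟩ | ⟨a, x', s', hx, h, -⟩ | ⟨h, -⟩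
      · exact h2 c hc _ h
      · exact h4 a ⟨s', .inr ⟨c, hc, h⟩⟩ ⟨x', hx⟩
      · simp at h

/-- The trace `σ` does not start with an action from `Y`. -/
def NotHead (Y : Set ℕ) (σ : PFT) : Prop := ∀ a σ', σ = Sum.inl a :: σ' → a ∉ Y

/-- `Trans s σ ρ`: a partial failure trace `σ` of the argument, in state `s`, gives rise to
the partial failure trace `ρ` of the composed process. -/
inductive Trans : St → PFT → PFT → Prop
  | nil {s} : Trans s [] []
  | aloneTau {s s' σ ρ} : L.alone s .tau s' → Trans s' σ ρ → Trans s σ ρ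
  | aloneAct {s s' c σ ρ} : L.alone s (.act c) s' → Trans s' σ ρ →
      Trans s σ (Sum.inl c :: ρ)
  | combTau {s s' a σ ρ} : L.comb s a .tau s' → Trans s' σ ρ → Trans s (Sum.inl a :: σ) ρ
  | combAct {s s' a c σ ρ} : L.comb s a (.act c) s' → Trans s' σ ρ →
      Trans s (Sum.inl a :: σ) (Sum.inl c :: ρ)
  | refusal {s X σ ρ} : L.Quiet s X → NotHead (L.refSet s X) σ → Trans s σ ρ →
      Trans s (Sum.inr (L.refSet s X) :: σ) (Sum.inr X :: ρ)
  | aloneRef {s s' X σ ρ} : L.Quiet s X → NotHead (L.refSet s X) σ →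
      L.alone s .timeout s' → Trans s' σ (Sum.inr X :: ρ) →
      Trans s (Sum.inr (L.refSet s X) :: σ) (Sum.inr X :: ρ)
  | aloneTimeoutAct {s s' X c σ ρ} : L.Quiet s X → NotHead (L.refSet s X) σ →
      L.alone s .timeout s' → Trans s' σ (Sum.inl c :: ρ) → c ∈ X →
      Trans s (Sum.inr (L.refSet s X) :: σ) (Sum.inr X :: Sum.inl c :: ρ)
  | argRef {s X a σ ρ} : L.Quiet s X → a ∈ L.refSet s X →
      Trans s (Sum.inl a :: σ) (Sum.inr X :: ρ) →
      Trans s (Sum.inr (L.refSet s X) :: Sum.inl a :: σ) (Sum.inr X :: ρ)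
  | argAct {s X a c σ ρ} : L.Quiet s X → a ∈ L.refSet s X →
      Trans s (Sum.inl a :: σ) (Sum.inl c :: ρ) → c ∈ X →
      Trans s (Sum.inr (L.refSet s X) :: Sum.inl a :: σ) (Sum.inr X :: Sum.inl c :: ρ)

end LinearOp

/-- A stable process performs the first action of its trace immediately. -/
lemma fft.mem_initials {P : Expr} {a : ℕ} {ρ : PFT} (h : fft P (Sum.inl a :: ρ))
    (hs : stable P) : a ∈ initials P := by
  cases h with
  | act h _ => exact ⟨_, h⟩
  | tau h _ => exact absurd ⟨_, h⟩ hs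

/-- Induction for traces starting with an action. -/
lemma fft.act_induction {G : Expr → Prop} {a : ℕ} {σ : PFT}
    (hact : ∀ x x', Step x (.act a) x' → fft x' σ → G x)
    (htau : ∀ x x', Step x .tau x' → G x' → G x) {x : Expr}
    (h : fft x (Sum.inl a :: σ)) : G x := by
  generalize hρ : (Sum.inl a :: σ : PFT) = ρ at h
  induction h with
  | act h1 h2 _ => cases hρ; exact hact _ _ h1 h2
  | tau h1 _ ih => exact htau _ _ h1 (ih hρ)
  | _ => cases hρ

/-- Induction for traces starting with a refusal set. -/
lemma fft.ref_induction {G : Expr → Prop} {Y : Set ℕ} {σ : PFT}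
    (htau : ∀ x x', Step x .tau x' → G x' → G x)
    (href : ∀ x, stable x → (∀ a ∈ Y, a ∉ initials x) → fft x σ → G x)
    (htime : ∀ x x', stable x → (∀ a ∈ Y, a ∉ initials x) → Step x .timeout x' → G x' → G x)
    (hact : ∀ x x' a σ', stable x → (∀ a ∈ Y, a ∉ initials x) → Step x .timeout x' →
      σ = Sum.inl a :: σ' → a ∈ Y → fft x' σ → G x)
    {x : Expr} (h : fft x (Sum.inr Y :: σ)) : G x := by
  generalize hρ : (Sum.inr Y :: σ : PFT) = ρ at h
  induction h with
  | tau h1 _ ih => exact htau _ _ h1 (ih hρ)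
  | refusal h1 h2 h3 _ => cases hρ; exact href _ h2 h1 h3
  | timeoutRef h1 h2 h3 _ ih => cases hρ; exact htime _ _ h2 h1 h3 (ih rfl)
  | timeoutAct h1 h2 h3 h4 h5 _ => cases hρ; exact hact _ _ _ _ h2 h1 h3 rfl h5 h4
  | _ => cases hρ

namespace LinearOp

variable {St : Type} {op : St → Expr → Expr} (L : LinearOp op)

include L in
lemma fft_tau {s : St} {ρ : PFT} (x x' : Expr) (h : Step x .tau x') (h' : fft (op s x') ρ) :
    fft (op s x) ρ :=
  .tau ((L.step_iff _ _ _ _).2 (.inr (.inr ⟨.inl rfl, x', h, rfl⟩))) h'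

include L in
lemma step_timeout (s : St) {x x' : Expr} (h : Step x .timeout x') :
    Step (op s x) .timeout (op s x') :=
  (L.step_iff _ _ _ _).2 (.inr (.inr ⟨.inr rfl, x', h, rfl⟩))

lemma fft_of_notHead {s : St} {X : Set ℕ} {σ ρ : PFT} (hq : L.Quiet s X)
    (hn : NotHead (L.refSet s X) σ)
    (H : ∀ x, stable (op s x) → (∀ c ∈ X, c ∉ initials (op s x)) → fft x σ →
      fft (op s x) (Sum.inr X :: ρ)) {x : Expr}
    (h : fft x (Sum.inr (L.refSet s X) :: σ)) : fft (op s x) (Sum.inr X :: ρ) := by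
  refine fft.ref_induction (G := fun x => fft (op s x) (Sum.inr X :: ρ)) L.fft_tau ?_ ?_ ?_ h
  · intro x h1 h2 h3
    obtain ⟨h4, h5⟩ := (L.stable_refuses_iff s X x).2 ⟨hq, h1, h2⟩
    exact H x h4 h5 h3
  · intro x x' h1 h2 h3 h4
    obtain ⟨h5, h6⟩ := (L.stable_refuses_iff s X x).2 ⟨hq, h1, h2⟩
    exact .timeoutRef h6 h5 (L.step_timeout s h3) h4
  · intro x x' a σ' _ _ _ h4 h5 _
    exact absurd h5 (hn _ _ h4)

lemma fft_of_head {s : St} {X : Set ℕ} {a : ℕ} {σ ρ : PFT} (hq : L.Quiet s X)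
    (ha : a ∈ L.refSet s X)
    (H : ∀ x x', stable (op s x) → (∀ c ∈ X, c ∉ initials (op s x)) →
      Step (op s x) .timeout (op s x') → fft x' (Sum.inl a :: σ) →
      fft (op s x) (Sum.inr X :: ρ)) {x : Expr}
    (h : fft x (Sum.inr (L.refSet s X) :: Sum.inl a :: σ)) :
    fft (op s x) (Sum.inr X :: ρ) := by
  refine fft.ref_induction (G := fun x => fft (op s x) (Sum.inr X :: ρ)) L.fft_tau ?_ ?_ ?_ h
  · intro x h1 h2 h3
    exact absurd (h3.mem_initials h1) (h2 a ha)
  · intro x x' h1 h2 h3 h4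
    obtain ⟨h5, h6⟩ := (L.stable_refuses_iff s X x).2 ⟨hq, h1, h2⟩
    exact .timeoutRef h6 h5 (L.step_timeout s h3) h4
  · intro x x' _ _ h1 h2 h3 _ _ h4
    obtain ⟨h5, h6⟩ := (L.stable_refuses_iff s X x).2 ⟨hq, h1, h2⟩
    exact H x x' h5 h6 (L.step_timeout s h3) h4

lemma Trans.fft_op {s : St} {σ ρ : PFT} (h : L.Trans s σ ρ) :
    ∀ x, fft x σ → fft (op s x) ρ := by
  induction h with
  | nil => exact fun _ _ => .top
  | aloneTau h _ ih =>
    exact fun x hx => .tau ((L.step_iff _ _ _ _).2 (.inl ⟨_, h, rfl⟩)) (ih x hx)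
  | aloneAct h _ ih =>
    exact fun x hx => .act ((L.step_iff _ _ _ _).2 (.inl ⟨_, h, rfl⟩)) (ih x hx)
  | combTau h _ ih =>
    exact fun x hx => fft.act_induction (G := fun x => fft (op _ x) _)
      (fun x x' h1 h2 => .tau ((L.step_iff _ _ _ _).2 (.inr (.inl ⟨_, _, _, h1, h, rfl⟩)))
        (ih x' h2)) L.fft_tau hx
  | combAct h _ ih =>
    exact fun x hx => fft.act_induction (G := fun x => fft (op _ x) _)
      (fun x x' h1 h2 => .act ((L.step_iff _ _ _ _).2 (.inr (.inl ⟨_, _, _, h1, h, rfl⟩)))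
        (ih x' h2)) L.fft_tau hx
  | refusal hq hn _ ih =>
    exact fun x hx => L.fft_of_notHead hq hn (fun x h1 h2 h3 => .refusal h2 h1 (ih x h3)) hx
  | aloneRef hq hn ht _ ih =>
    exact fun x hx => L.fft_of_notHead hq hn (fun x h1 h2 h3 =>
      .timeoutRef h2 h1 ((L.step_iff _ _ _ _).2 (.inl ⟨_, ht, rfl⟩)) (ih x h3)) hx
  | aloneTimeoutAct hq hn ht _ hc ih =>
    exact fun x hx => L.fft_of_notHead hq hn (fun x h1 h2 h3 =>
      .timeoutAct h2 h1 ((L.step_iff _ _ _ _).2 (.inl ⟨_, ht, rfl⟩)) (ih x h3) hc) hx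
  | argRef hq ha _ ih =>
    exact fun x hx => L.fft_of_head hq ha (fun x x' h1 h2 h3 h4 =>
      .timeoutRef h2 h1 h3 (ih x' h4)) hx
  | argAct hq ha _ hc ih =>
    exact fun x hx => L.fft_of_head hq ha (fun x x' h1 h2 h3 h4 =>
      .timeoutAct h2 h1 h3 (ih x' h4) hc) hx

lemma Trans.head_of_ref {s : St} {X : Set ℕ} {σ ρ : PFT} (hq : L.Quiet s X)
    (h : L.Trans s σ (Sum.inr X :: ρ)) :
    (∃ σ', σ = Sum.inr (L.refSet s X) :: σ') ∨
      ∃ a ∈ L.refSet s X, ∃ σ', σ = Sum.inl a :: σ' := by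
  cases h with
  | aloneTau h _ => exact absurd h (hq.1 _)
  | combTau h _ => exact .inr ⟨_, ⟨_, .inl h⟩, _, rfl⟩
  | _ => exact .inl ⟨_, rfl⟩

lemma Trans.head_of_act {s : St} {X : Set ℕ} {c : ℕ} {σ ρ : PFT} (hq : L.Quiet s X)
    (hc : c ∈ X) (h : L.Trans s σ (Sum.inl c :: ρ)) :
    ∃ a ∈ L.refSet s X, ∃ σ', σ = Sum.inl a :: σ' := by
  cases h with
  | aloneTau h _ => exact absurd h (hq.1 _)
  | aloneAct h _ => exact absurd h (hq.2 _ hc _)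
  | combTau h _ => exact ⟨_, ⟨_, .inl h⟩, _, rfl⟩
  | combAct h _ => exact ⟨_, ⟨_, .inr ⟨_, hc, h⟩⟩, _, rfl⟩

lemma notHead_of_fft {x : Expr} {Y : Set ℕ} {σ : PFT} (hs : stable x)
    (hr : ∀ a ∈ Y, a ∉ initials x) (h : fft x σ) : NotHead Y σ := by
  rintro a σ' rfl ha
  exact hr a ha (h.mem_initials hs)

lemma exists_trans {z : Expr} {ρ : PFT} (h : fft z ρ) :
    ∀ s x, z = op s x → ∃ σ, fft x σ ∧ L.Trans s σ ρ := by
  induction h with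
  | top => exact fun s x _ => ⟨[], .top, .nil⟩
  | act hz _ ih =>
    rintro s x rfl
    rcases (L.step_iff _ _ _ _).1 hz with ⟨s', h, rfl⟩ | ⟨a, x', s', hx, h, rfl⟩ | ⟨h, -⟩
    · obtain ⟨σ, h1, h2⟩ := ih s' x rfl
      exact ⟨σ, h1, .aloneAct h h2⟩
    · obtain ⟨σ, h1, h2⟩ := ih s' x' rfl
      exact ⟨_, .act hx h1, .combAct h h2⟩
    · simp at h
  | tau hz _ ih =>
    rintro s x rfl
    rcases (L.step_iff _ _ _ _).1 hz with ⟨s', h, rfl⟩ | ⟨a, x', s', hx, h, rfl⟩ | ⟨-, x', h, rfl⟩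
    · obtain ⟨σ, h1, h2⟩ := ih s' x rfl
      exact ⟨σ, h1, .aloneTau h h2⟩
    · obtain ⟨σ, h1, h2⟩ := ih s' x' rfl
      exact ⟨_, .act hx h1, .combTau h h2⟩
    · obtain ⟨σ, h1, h2⟩ := ih s x' rfl
      exact ⟨_, .tau h h1, h2⟩
  | refusal hr hs _ ih =>
    rintro s x rfl
    obtain ⟨hq, h1, h2⟩ := (L.stable_refuses_iff _ _ _).1 ⟨hs, hr⟩
    obtain ⟨σ, h3, h4⟩ := ih s x rfl
    exact ⟨_, .refusal h2 h1 h3, .refusal hq (notHead_of_fft h1 h2 h3) h4⟩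
  | timeoutRef hr hs hz _ ih =>
    rintro s x rfl
    obtain ⟨hq, h1, h2⟩ := (L.stable_refuses_iff _ _ _).1 ⟨hs, hr⟩
    rcases (L.step_iff _ _ _ _).1 hz with ⟨s', h, rfl⟩ | ⟨a, x', s', hx, h, rfl⟩ | ⟨-, x', h, rfl⟩
    · obtain ⟨σ, h3, h4⟩ := ih s' x rfl
      exact ⟨_, .refusal h2 h1 h3, .aloneRef hq (notHead_of_fft h1 h2 h3) h h4⟩
    · exact absurd h (L.comb_timeout _ _ _)
    · obtain ⟨σ, h3, h4⟩ := ih s x' rfl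
      rcases h4.head_of_ref L hq with ⟨σ', rfl⟩ | ⟨a, ha, σ', rfl⟩
      · exact ⟨_, .timeoutRef h2 h1 h h3, h4⟩
      · exact ⟨_, .timeoutAct h2 h1 h h3 ha, .argRef hq ha h4⟩
  | timeoutAct hr hs hz _ hc ih =>
    rintro s x rfl
    obtain ⟨hq, h1, h2⟩ := (L.stable_refuses_iff _ _ _).1 ⟨hs, hr⟩
    rcases (L.step_iff _ _ _ _).1 hz with ⟨s', h, rfl⟩ | ⟨a, x', s', hx, h, rfl⟩ | ⟨-, x', h, rfl⟩
    · obtain ⟨σ, h3, h4⟩ := ih s' x rfl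
      exact ⟨_, .refusal h2 h1 h3, .aloneTimeoutAct hq (notHead_of_fft h1 h2 h3) h h4 hc⟩
    · exact absurd h (L.comb_timeout _ _ _)
    · obtain ⟨σ, h3, h4⟩ := ih s x' rfl
      obtain ⟨a, ha, σ', rfl⟩ := h4.head_of_act L hq hc
      exact ⟨_, .timeoutAct h2 h1 h h3 ha, .argAct hq ha h4 hc⟩

include L in
/-- Linear operators are monotone for the partial failure trace preorder. -/
lemma fftSet_mono (s : St) {P Q : Expr} (h : fftSet Q ⊆ fftSet P) :
    fftSet (op s Q) ⊆ fftSet (op s P) := by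
  intro ρ hρ
  obtain ⟨σ, h1, h2⟩ := L.exists_trans hρ s Q rfl
  exact h2.fft_op L P (h h1)

end LinearOp

/-- Hiding as a linear operator. -/
def absOp (I : Set ℕ) : LinearOp (fun _ : Unit => Expr.abs I) where
  alone _ _ _ := False
  comb _ a α _ := (a ∈ I ∧ α = .tau) ∨ (a ∉ I ∧ α = .act a)
  comb_timeout := by simp
  step_iff s x α z := by
    constructor
    · intro h
      cases h with
      | @absFree _ _ _ x' h1 h2 =>
        cases α with
        | act a => exact .inr (.inl ⟨a, x', (), h1, .inr ⟨h2 a rfl, rfl⟩, rfl⟩)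
        | tau => exact .inr (.inr ⟨.inl rfl, x', h1, rfl⟩)
        | timeout => exact .inr (.inr ⟨.inr rfl, x', h1, rfl⟩)
      | @absHide _ _ a x' h1 h2 => exact .inr (.inl ⟨a, x', (), h1, .inl ⟨h2, rfl⟩, rfl⟩)
    · rintro (⟨_, h, -⟩ | ⟨a, x', _, h, ⟨h1, rfl⟩ | ⟨h1, rfl⟩, rfl⟩ | ⟨h1, x', h, rfl⟩)
      · exact h.elim
      · exact .absHide h h1
      · exact .absFree h (by rintro _ ⟨⟩; exact h1)
      · exact .absFree h (by rcases h1 with rfl | rfl <;> rintro _ ⟨⟩)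

/-- Renaming as a linear operator. -/
def renOp (R : Set (ℕ × ℕ)) : LinearOp (fun _ : Unit => Expr.ren R) where
  alone _ _ _ := False
  comb _ a α _ := ∃ c, (a, c) ∈ R ∧ α = .act c
  comb_timeout := by simp
  step_iff s x α z := by
    constructor
    · intro h
      cases h with
      | renTau h => exact .inr (.inr ⟨.inl rfl, _, h, rfl⟩)
      | renTimeout h => exact .inr (.inr ⟨.inr rfl, _, h, rfl⟩)
      | renAct h h1 => exact .inr (.inl ⟨_, _, (), h, ⟨_, h1, rfl⟩, rfl⟩)
    · rintro (⟨_, h, -⟩ | ⟨a, x', _, h, ⟨c, h1, rfl⟩, rfl⟩ | ⟨rfl | rfl, x', h, rfl⟩)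
      · exact h.elim
      · exact .renAct h h1
      · exact .renTau h
      · exact .renTimeout h

/-- Parallel composition as a linear operator in its left argument. -/
def parLOp (S : Set ℕ) : LinearOp (fun y x : Expr => Expr.par S x y) where
  alone y α y' := α.notIn S ∧ Step y α y'
  comb y a α y' := α = .act a ∧ ((a ∉ S ∧ y' = y) ∨ (a ∈ S ∧ Step y α y'))
  comb_timeout := by simp
  step_iff s x α z := by
    constructor
    · intro h
      cases h with
      | @parL _ _ _ _ x' h h1 =>
        cases α with
        | act a => exact .inr (.inl ⟨a, x', s, h, ⟨rfl, .inl ⟨h1 a rfl, rfl⟩⟩, rfl⟩)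
        | tau => exact .inr (.inr ⟨.inl rfl, x', h, rfl⟩)
        | timeout => exact .inr (.inr ⟨.inr rfl, x', h, rfl⟩)
      | parR h h1 => exact .inl ⟨_, ⟨h1, h⟩, rfl⟩
      | parSync h h1 h2 => exact .inr (.inl ⟨_, _, _, h, ⟨rfl, .inr ⟨h2, h1⟩⟩, rfl⟩)
    · rintro (⟨_, ⟨h1, h⟩, rfl⟩ | ⟨a, x', _, h, ⟨rfl, ⟨h1, rfl⟩ | ⟨h1, h2⟩⟩, rfl⟩ |
        ⟨h1, x', h, rfl⟩)
      · exact .parR h h1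
      · exact .parL h (by rintro _ ⟨⟩; exact h1)
      · exact .parSync h h2 h1
      · exact .parL h (by rcases h1 with rfl | rfl <;> rintro _ ⟨⟩)

lemma Step.par_comm {S : Set ℕ} {x y z : Expr} {α : Act} (h : Step (.par S x y) α z) :
    ∃ x' y', z = .par S x' y' ∧ Step (.par S y x) α (.par S y' x') := by
  cases h with
  | parL h h1 => exact ⟨_, _, rfl, .parR h h1⟩
  | parR h h1 => exact ⟨_, _, rfl, .parL h h1⟩
  | parSync h h1 h2 => exact ⟨_, _, rfl, .parSync h1 h h2⟩

/-- Parallel composition as a linear operator in its right argument. -/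
def parROp (S : Set ℕ) : LinearOp (fun y x : Expr => Expr.par S y x) where
  alone := (parLOp S).alone
  comb := (parLOp S).comb
  comb_timeout := (parLOp S).comb_timeout
  step_iff s x α z := by
    constructor
    · intro hz
      obtain ⟨y', x', rfl, hz'⟩ := hz.par_comm
      rcases ((parLOp S).step_iff _ _ _ _).1 hz' with
        ⟨s', h, he⟩ | ⟨a, x', s', hx, h, he⟩ | ⟨h1, x', h, he⟩ <;> cases he
      · exact .inl ⟨_, h, rfl⟩
      · exact .inr (.inl ⟨_, _, _, hx, h, rfl⟩)
      · exact .inr (.inr ⟨h1, _, h, rfl⟩)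
    · have key : ∀ s' x', Step (.par S x s) α (.par S x' s') →
          Step (.par S s x) α (.par S s' x') := by
        intro s' x' h
        obtain ⟨_, _, he, h'⟩ := h.par_comm
        cases he
        exact h'
      rintro (⟨s', h, rfl⟩ | ⟨a, x', s', hx, h, rfl⟩ | ⟨h1, x', h, rfl⟩) <;>
        refine key _ _ (((parLOp S).step_iff _ _ _ _).2 ?_)
      · exact .inl ⟨_, h, rfl⟩
      · exact .inr (.inl ⟨_, _, _, hx, h, rfl⟩)
      · exact .inr (.inr ⟨h1, _, h, rfl⟩)

/-- The guarded sum of `α.E` and the summands of `f`. -/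
def consSum (f : ℕ → Option (Act × Expr)) (α : Act) (E : Expr) : Expr :=
  .gsum (fun i => Nat.casesOn i (some (α, E)) f)

lemma step_consSum {f : ℕ → Option (Act × Expr)} {α β : Act} {E F : Expr} :
    Step (consSum f α E) β F ↔ (β = α ∧ F = E) ∨ ∃ i, f i = some (β, F) := by
  constructor
  · intro h
    cases h with
    | @gsum _ i _ _ h =>
      cases i with
      | zero => simp at h; exact .inl ⟨h.1.symm, h.2.symm⟩
      | succ i => exact .inr ⟨i, h⟩
  · rintro (⟨rfl, rfl⟩ | ⟨i, h⟩)
    · exact .gsum (i := 0) rfl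
    · exact .gsum (i := i + 1) h

lemma step_consSum_label {f : ℕ → Option (Act × Expr)} {α β : Act} (P Q : Expr) :
    (∃ F, Step (consSum f α P) β F) ↔ ∃ F, Step (consSum f α Q) β F := by
  simp only [step_consSum, exists_or, exists_and_left, exists_eq, and_true]

lemma fftSet_consSum_mono (f : ℕ → Option (Act × Expr)) (α : Act) {P Q : Expr}
    (h : fftSet Q ⊆ fftSet P) : fftSet (consSum f α Q) ⊆ fftSet (consSum f α P) := by
  intro ρ hρ
  have hst : stable (consSum f α Q) → stable (consSum f α P) :=
    fun hs hp => hs ((step_consSum_label P Q).1 hp)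
  have hin : ∀ X : Set ℕ, (∀ a ∈ X, a ∉ initials (consSum f α Q)) →
      ∀ a ∈ X, a ∉ initials (consSum f α P) :=
    fun X hX a ha hp => hX a ha ((step_consSum_label P Q).1 hp)
  have hmove : ∀ {β F σ}, Step (consSum f α Q) β F → fft F σ →
      ∃ F', Step (consSum f α P) β F' ∧ fft F' σ := by
    intro β F σ hs hF
    rcases step_consSum.1 hs with ⟨rfl, rfl⟩ | hi
    · exact ⟨P, step_consSum.2 (.inl ⟨rfl, rfl⟩), h hF⟩
    · exact ⟨F, step_consSum.2 (.inr hi), hF⟩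
  change fft _ ρ at hρ
  change fft _ ρ
  generalize hz : consSum f α Q = z at hρ
  induction hρ with
  | top => exact .top
  | act h1 h2 _ =>
    subst hz
    obtain ⟨F, h3, h4⟩ := hmove h1 h2
    exact .act h3 h4
  | tau h1 h2 _ =>
    subst hz
    obtain ⟨F, h3, h4⟩ := hmove h1 h2
    exact .tau h3 h4
  | refusal h1 h2 _ ih =>
    subst hz
    exact .refusal (hin _ h1) (hst h2) (ih rfl)
  | timeoutRef h1 h2 h3 h4 _ =>
    subst hz
    obtain ⟨F, h5, h6⟩ := hmove h3 h4
    exact .timeoutRef (hin _ h1) (hst h2) h5 h6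
  | timeoutAct h1 h2 h3 h4 h5 _ =>
    subst hz
    obtain ⟨F, h6, h7⟩ := hmove h3 h4
    exact .timeoutAct (hin _ h1) (hst h2) h6 h7 h5

lemma GCtx.fftSet_fill_mono (C : GCtx) {P Q : Expr} (h : fftSet Q ⊆ fftSet P) :
    fftSet (C.fill Q) ⊆ fftSet (C.fill P) := by
  induction C with
  | hole => exact h
  | gsum f α C ih => exact fftSet_consSum_mono f α ih
  | parL S C F ih => exact (parLOp S).fftSet_mono F ih
  | parR S F C ih => exact (parROp S).fftSet_mono F ih
  | abs I C ih => exact (absOp I).fftSet_mono () ih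
  | ren R C ih => exact (renOp R).fftSet_mono () ih

/-! ### Testing -/

/-- `Win b N`: the process `N`, left alone, can reach a state performing `b`. -/
inductive Win (b : ℕ) : Expr → Prop
  | done {N N'} : Step N (.act b) N' → Win b N
  | tau {N N'} : Step N .tau N' → Win b N' → Win b N
  | timeout {N N'} : stable N → Step N .timeout N' → Win b N' → Win b N

lemma Win.fft {b : ℕ} {N : Expr} (h : Win b N) :
    fft N [Sum.inl b] ∨ fft N [Sum.inr {b}, Sum.inl b] := by
  induction h with
  | done h => exact .inl (.act h .top)
  | tau h _ ih => exact ih.imp (.tau h) (.tau h)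
  | @timeout N N' hs h _ ih =>
    by_cases hb : b ∈ initials N
    · obtain ⟨M, hM⟩ := hb
      exact .inl (.act hM .top)
    · have hr : ∀ a ∈ ({b} : Set ℕ), a ∉ initials N := by rintro a rfl; exact hb
      exact .inr (ih.elim (fun h' => .timeoutAct hr hs h h' rfl) (.timeoutRef hr hs h))

lemma Win.not_safety {b : ℕ} {N : Expr} (h : Win b N) : ¬ Safety b N := by
  intro hs
  rcases h.fft with h | h <;> exact hs _ h (by simp)

/-- The order-preserving enumeration of the actions other than `b`. -/
def skip (b n : ℕ) : ℕ := if n < b then n else n + 1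

lemma skip_ne (b n : ℕ) : skip b n ≠ b := by unfold skip; split <;> omega

lemma skip_injective (b : ℕ) : Function.Injective (skip b) := by
  intro m n h
  unfold skip at h
  split at h <;> split at h <;> omega

/-- The context in which the renamed argument is tested by `T`, hiding all actions but `b`. -/
def testCtx (b : ℕ) (T : Expr) : GCtx :=
  .abs {b}ᶜ (.parL {b}ᶜ (.ren {p | p.2 = skip b p.1} .hole) T)

lemma step_testCtx {b : ℕ} {T P Z : Expr} {α : Act} :
    Step ((testCtx b T).fill P) α Z ↔
      ((α = .tau ∨ α = .timeout) ∧ ∃ P', Step P α P' ∧ Z = (testCtx b T).fill P') ∨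
      ((∀ a, α = .act a → a = b) ∧ ∃ T', Step T α T' ∧ Z = (testCtx b T').fill P) ∨
      (α = .tau ∧ ∃ a P' T', Step P (.act a) P' ∧ Step T (.act (skip b a)) T' ∧
        Z = (testCtx b T').fill P') := by
  constructor
  · intro h
    cases h with
    | absFree h hα =>
      cases h with
      | parL h _ =>
        cases h with
        | renTau h => exact .inl ⟨.inl rfl, _, h, rfl⟩
        | renTimeout h => exact .inl ⟨.inr rfl, _, h, rfl⟩
        | @renAct _ _ _ a c h hr =>
          change c = skip b a at hr
          subst hr
          exact absurd (skip_ne b _) (hα _ rfl)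
      | parR h _ =>
        exact .inr (.inl ⟨fun a ha => not_not.1 (hα a ha), _, h, rfl⟩)
      | parSync h h' hs => exact absurd hs (hα _ rfl)
    | absHide h ha =>
      cases h with
      | parL _ hα => exact absurd ha (hα _ rfl)
      | parR _ hα => exact absurd ha (hα _ rfl)
      | parSync h h' _ =>
        cases h with
        | @renAct _ _ _ a _ h hr =>
          change _ = skip b a at hr
          subst hr
          exact .inr (.inr ⟨rfl, _, _, _, h, h', rfl⟩)
  · rintro (⟨rfl | rfl, P', h, rfl⟩ | ⟨hα, T', h, rfl⟩ | ⟨rfl, a, P', T', h, h', rfl⟩)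
    · exact .absFree (.parL (.renTau h) (by rintro _ ⟨⟩)) (by rintro _ ⟨⟩)
    · exact .absFree (.parL (.renTimeout h) (by rintro _ ⟨⟩)) (by rintro _ ⟨⟩)
    · exact .absFree (.parR h fun a ha hb => hb (hα a ha)) fun a ha hb => hb (hα a ha)
    · exact .absHide (.parSync (.renAct h (by exact rfl)) h' (skip_ne b a)) (skip_ne b a)

lemma stable_testCtx {b : ℕ} {T P : Expr} :
    stable ((testCtx b T).fill P) ↔
      stable P ∧ stable T ∧ ∀ a ∈ initials P, skip b a ∉ initials T := by
  constructor
  · intro h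
    refine ⟨fun ⟨P', hP⟩ => h ⟨_, step_testCtx.2 (.inl ⟨.inl rfl, P', hP, rfl⟩)⟩,
      fun ⟨T', hT⟩ => h ⟨_, step_testCtx.2 (.inr (.inl ⟨by rintro _ ⟨⟩, T', hT, rfl⟩))⟩, ?_⟩
    rintro a ⟨P', hP⟩ ⟨T', hT⟩
    exact h ⟨_, step_testCtx.2 (.inr (.inr ⟨rfl, a, P', T', hP, hT, rfl⟩))⟩
  · rintro ⟨h1, h2, h3⟩ ⟨Z, hZ⟩
    rcases step_testCtx.1 hZ with ⟨-, P', h, -⟩ | ⟨-, T', h, -⟩ | ⟨-, a, P', T', h, h', -⟩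
    · exact h1 ⟨_, h⟩
    · exact h2 ⟨_, h⟩
    · exact h3 a ⟨_, h⟩ ⟨_, h'⟩

lemma win_of_fft_mem {b : ℕ} {N : Expr} {ρ : PFT} (h : fft N ρ) :
    ∀ P T, N = (testCtx b T).fill P → Sum.inl b ∈ ρ → Win b N := by
  have next : ∀ {α N' P T}, Step ((testCtx b T).fill P) α N' →
      ∃ P' T', N' = (testCtx b T').fill P' := by
    intro α N' P T hs
    rcases step_testCtx.1 hs with ⟨-, P', -, h⟩ | ⟨-, T', -, h⟩ | ⟨-, a, P', T', -, -, h⟩ <;>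
      exact ⟨_, _, h⟩
  induction h with
  | top => intro _ _ _ h; cases h
  | act h _ _ =>
    rintro P T rfl -
    rcases step_testCtx.1 h with ⟨h', -⟩ | ⟨h', -⟩ | ⟨h', -⟩
    · simp at h'
    · cases h' _ rfl; exact .done h
    · cases h'
  | tau h _ ih =>
    rintro P T rfl hb
    obtain ⟨P', T', h'⟩ := next h
    exact .tau h (ih _ _ h' hb)
  | refusal _ _ _ ih =>
    rintro P T hN hb
    exact ih P T hN (by simpa using hb)
  | timeoutRef _ hs h _ ih =>
    rintro P T rfl hb
    obtain ⟨P', T', h'⟩ := next h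
    exact .timeout hs h (ih _ _ h' hb)
  | timeoutAct _ hs h _ _ ih =>
    rintro P T rfl hb
    obtain ⟨P', T', h'⟩ := next h
    exact .timeout hs h (ih _ _ h' (by simpa using hb))

lemma safety_testCtx_iff {b : ℕ} {T P : Expr} :
    Safety b ((testCtx b T).fill P) ↔ ¬ Win b ((testCtx b T).fill P) :=
  ⟨fun hs hw => hw.not_safety hs, fun hw _ h hb => hw (win_of_fft_mem h P T rfl hb)⟩

open Classical in
/-- The test that fails on the actions from `X` and otherwise continues with `α.E`. -/
noncomputable def refTest (b : ℕ) (X : Set ℕ) (α : Act) (E : Expr) : Expr :=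
  consSum (fun n => if n ∈ X then some (.act (skip b n), .nil) else none) α E

lemma step_refTest {b : ℕ} {X : Set ℕ} {α β : Act} {E F : Expr} :
    Step (refTest b X α E) β F ↔
      (β = α ∧ F = E) ∨ ∃ n ∈ X, β = .act (skip b n) ∧ F = .nil := by
  simp only [refTest, step_consSum]
  refine or_congr_right (exists_congr fun n => ?_)
  by_cases h : n ∈ X <;> simp [h, eq_comm]

/-- The test for an action `a` that may not be preceded by a time-out. -/
def actTest (b a : ℕ) (E : Expr) : Expr :=
  consSum (fun n => Nat.casesOn n (some (.tau, .nil)) fun _ => none) (.act (skip b a)) E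

lemma step_actTest {b a : ℕ} {β : Act} {E F : Expr} :
    Step (actTest b a E) β F ↔ (β = .act (skip b a) ∧ F = E) ∨ (β = .tau ∧ F = .nil) := by
  rw [actTest, step_consSum]
  refine or_congr_right ⟨?_, ?_⟩
  · rintro ⟨_ | _, h⟩
    · simp at h; exact ⟨h.1.symm, h.2.symm⟩
    · cases h
  · rintro ⟨rfl, rfl⟩
    exact ⟨0, rfl⟩

open Classical in
/-- The test for the partial failure trace `σ`; success is reported by `b`. -/
noncomputable def test (b : ℕ) : PFT → Expr
  | [] => .pre (.act b) .nil
  | Sum.inl a :: ρ => actTest b a (test b ρ)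
  | [Sum.inr X] => refTest b X .timeout (test b [])
  | Sum.inr X :: Sum.inr Y :: ρ => refTest b X .timeout (test b (Sum.inr Y :: ρ))
  | Sum.inr X :: Sum.inl a :: ρ =>
    if a ∈ X then refTest b X .timeout (refTest b X (.act (skip b a)) (test b ρ))
    else refTest b X .timeout (test b (Sum.inl a :: ρ))

lemma test_ref_of_mem {b a : ℕ} {X : Set ℕ} {ρ : PFT} (h : a ∈ X) :
    test b (Sum.inr X :: Sum.inl a :: ρ) =
      refTest b X .timeout (refTest b X (.act (skip b a)) (test b ρ)) := by
  simp [test, h]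

lemma test_ref_of_notHead {b : ℕ} {X : Set ℕ} {ρ : PFT} (h : LinearOp.NotHead X ρ) :
    test b (Sum.inr X :: ρ) = refTest b X .timeout (test b ρ) := by
  rcases ρ with _ | ⟨a | Y, ρ⟩
  · simp [test]
  · simp [test, h a ρ rfl]
  · simp [test]

lemma mem_or_notHead (X : Set ℕ) (ρ : PFT) :
    (∃ a ∈ X, ∃ ρ', ρ = Sum.inl a :: ρ') ∨ LinearOp.NotHead X ρ := by
  by_cases h : ∃ a ∈ X, ∃ ρ', ρ = Sum.inl a :: ρ'
  · exact .inl h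
  · exact .inr fun a ρ' h1 h2 => h ⟨a, h2, ρ', h1⟩

lemma exists_test_ref (b : ℕ) (X : Set ℕ) (ρ : PFT) :
    ∃ E, test b (Sum.inr X :: ρ) = refTest b X .timeout E := by
  rcases mem_or_notHead X ρ with ⟨a, ha, ρ', rfl⟩ | h
  · exact ⟨_, test_ref_of_mem ha⟩
  · exact ⟨_, test_ref_of_notHead h⟩

/-- Closed well-formed expressions without `+` that are allowed in contexts. -/
def Good (E : Expr) : Prop := IsProcess E ∧ NoPlus E

lemma good_nil : Good .nil := ⟨⟨(fun _ h => by cases h), .nil⟩, .nil⟩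

lemma good_consSum {f : ℕ → Option (Act × Expr)} {α : Act} {E : Expr} (hE : Good E)
    (hf : ∀ i β F, f i = some (β, F) → Good F) : Good (consSum f α E) := by
  have key : ∀ i β F, (Nat.casesOn i (some (α, E)) f : Option (Act × Expr)) = some (β, F) →
      Good F := by
    rintro (_ | i) β F h
    · cases h; exact hE
    · exact hf i β F h
  refine ⟨⟨fun x h => ?_, .gsum fun i β F h => (key i β F h).1.2⟩,
    .gsum fun i β F h => (key i β F h).2⟩
  cases h with
  | gsum h h' => exact (key _ _ _ h).1.1 x h'

lemma good_refTest {b : ℕ} {X : Set ℕ} {α : Act} {E : Expr} (hE : Good E) :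
    Good (refTest b X α E) := by
  refine good_consSum hE fun i β F h => ?_
  split at h
  · cases h; exact good_nil
  · cases h

lemma good_actTest {b a : ℕ} {E : Expr} (hE : Good E) : Good (actTest b a E) := by
  refine good_consSum hE fun i β F h => ?_
  rcases i with _ | i
  · cases h; exact good_nil
  · cases h

lemma good_test (b : ℕ) (σ : PFT) : Good (test b σ) := by
  fun_induction test b σ with
  | case1 => exact ⟨⟨fun x h => (by cases h with | pre h => cases h), .pre .nil⟩, .pre .nil⟩
  | case2 _ _ ih => exact good_actTest ih
  | case3 _ ih => exact good_refTest ih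
  | case4 _ _ _ ih => exact good_refTest ih
  | case5 _ _ _ _ ih => exact good_refTest (good_refTest ih)
  | case6 _ _ _ _ ih => exact good_refTest ih

lemma testCtx_ok (b : ℕ) (σ : PFT) : GCtx.OK (testCtx b (test b σ)) := by
  refine .abs (.parL (.ren (fun a => ?_) .hole) (good_test b σ).1 (good_test b σ).2)
  exact Set.finite_singleton (skip b a)

lemma stable_refTest {b : ℕ} {X : Set ℕ} {α : Act} {E : Expr} (h : α ≠ .tau) :
    stable (refTest b X α E) := by
  rintro ⟨F, hF⟩
  rcases step_refTest.1 hF with ⟨h', -⟩ | ⟨n, -, h', -⟩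
  · exact h h'.symm
  · cases h'

lemma stable_testCtx_refTest {b : ℕ} {X : Set ℕ} {α : Act} {E P : Expr} (hα : α ≠ .tau)
    (hX : ∀ c, α = .act c → ∃ a ∈ X, c = skip b a) :
    stable ((testCtx b (refTest b X α E)).fill P) ↔
      stable P ∧ ∀ a ∈ X, a ∉ initials P := by
  rw [stable_testCtx]
  constructor
  · rintro ⟨h1, -, h2⟩
    exact ⟨h1, fun a ha hp => h2 a hp ⟨_, step_refTest.2 (.inr ⟨a, ha, rfl, rfl⟩)⟩⟩
  · rintro ⟨h1, h2⟩
    refine ⟨h1, stable_refTest hα, ?_⟩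
    rintro a ha ⟨F, hF⟩
    rcases step_refTest.1 hF with ⟨h, -⟩ | ⟨n, hn, h, -⟩
    · obtain ⟨a', ha', h⟩ := hX _ h.symm
      cases skip_injective b h
      exact h2 a ha' ha
    · cases skip_injective b (Act.act.inj h)
      exact h2 a hn ha

section

variable {b : ℕ} {P P' T T' : Expr}

lemma Win.of_tau (h : Step P .tau P') (hw : Win b ((testCtx b T).fill P')) :
    Win b ((testCtx b T).fill P) :=
  .tau (step_testCtx.2 (.inl ⟨.inl rfl, P', h, rfl⟩)) hw

lemma Win.of_sync {a : ℕ} (h : Step P (.act a) P') (h' : Step T (.act (skip b a)) T')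
    (hw : Win b ((testCtx b T').fill P')) : Win b ((testCtx b T).fill P) :=
  .tau (step_testCtx.2 (.inr (.inr ⟨rfl, a, P', T', h, h', rfl⟩))) hw

lemma Win.of_timeout (hs : stable ((testCtx b T).fill P)) (h : Step P .timeout P')
    (hw : Win b ((testCtx b T).fill P')) : Win b ((testCtx b T).fill P) :=
  .timeout hs (step_testCtx.2 (.inl ⟨.inr rfl, P', h, rfl⟩)) hw

lemma Win.of_test_timeout (hs : stable ((testCtx b T).fill P)) (h : Step T .timeout T')
    (hw : Win b ((testCtx b T').fill P)) : Win b ((testCtx b T).fill P) :=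
  .timeout hs (step_testCtx.2 (.inr (.inl ⟨by rintro _ ⟨⟩, T', h, rfl⟩))) hw

end

lemma win_refTest_act {b a : ℕ} {X : Set ℕ} {P : Expr} {ρ : PFT}
    (hρ : ∀ P, fft P ρ → Win b ((testCtx b (test b ρ)).fill P)) (h : fft P (Sum.inl a :: ρ)) :
    Win b ((testCtx b (refTest b X (.act (skip b a)) (test b ρ))).fill P) :=
  fft.act_induction (G := fun P => Win b ((testCtx b (refTest b X _ (test b ρ))).fill P))
    (fun _ _ h1 h2 => .of_sync h1 (step_refTest.2 (.inl ⟨rfl, rfl⟩)) (hρ _ h2))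
    (fun _ _ h1 h2 => .of_tau h1 h2) h

lemma win_of_fft {b : ℕ} {σ : PFT} {P : Expr} (h : fft P σ) :
    Win b ((testCtx b (test b σ)).fill P) := by
  have main : ∀ n (σ : PFT), σ.length < n → ∀ P, fft P σ →
      Win b ((testCtx b (test b σ)).fill P) := by
    intro n
    induction n with
    | zero => intro σ h; omega
    | succ n ih =>
      rintro (_ | ⟨a | X, ρ⟩) hl P h
      · exact .done (step_testCtx.2 (.inr (.inl ⟨by rintro _ ⟨⟩; rfl, .nil,
          by rw [test]; exact .pre, rfl⟩)))
      · rw [test]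
        exact fft.act_induction (G := fun P => Win b ((testCtx b (actTest b a _)).fill P))
          (fun _ _ h1 h2 => .of_sync h1 (step_actTest.2 (.inl ⟨rfl, rfl⟩))
            (ih ρ (by simp at hl; omega) _ h2))
          (fun _ _ h1 h2 => .of_tau h1 h2) h
      · have hstab : ∀ {E Q}, stable Q → (∀ a ∈ X, a ∉ initials Q) →
            stable ((testCtx b (refTest b X .timeout E)).fill Q) := fun h1 h2 =>
          (stable_testCtx_refTest (by simp) (by simp)).2 ⟨h1, h2⟩
        refine fft.ref_induction
          (G := fun P => Win b ((testCtx b (test b (Sum.inr X :: ρ))).fill P))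
          (fun _ _ h1 h2 => .of_tau h1 h2) ?_ ?_ ?_ h
        · intro P h1 h2 h3
          have hn : LinearOp.NotHead X ρ := LinearOp.notHead_of_fft h1 h2 h3
          rw [test_ref_of_notHead hn]
          exact .of_test_timeout (hstab h1 h2) (step_refTest.2 (.inl ⟨rfl, rfl⟩))
            (ih ρ (by simp at hl; omega) _ h3)
        · intro P P' h1 h2 h3 h4
          obtain ⟨E, hE⟩ := exists_test_ref b X ρ
          rw [hE] at h4 ⊢
          exact .of_timeout (hstab h1 h2) h3 h4
        · rintro P P' a ρ' h1 h2 h3 rfl ha h4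
          rw [test_ref_of_mem ha]
          refine .of_test_timeout (hstab h1 h2) (step_refTest.2 (.inl ⟨rfl, rfl⟩)) ?_
          refine .of_timeout ((stable_testCtx_refTest (by simp) ?_).2 ⟨h1, h2⟩) h3
            (win_refTest_act (ih ρ' (by simp at hl; omega)) h4)
          rintro c hc
          exact ⟨a, ha, (Act.act.inj hc).symm⟩
  exact main _ σ (Nat.lt_succ_self _) P h

/-- Soundness of the tests, for all states in which a test can be. -/
lemma fft_of_win_aux {b : ℕ} {N : Expr} (h : Win b N) :
    (∀ P, N ≠ (testCtx b .nil).fill P) ∧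
    (∀ P X a ρ, a ∈ X → N = (testCtx b (refTest b X (.act (skip b a)) (test b ρ))).fill P →
      fft P (Sum.inl a :: ρ) ∨ fft P (Sum.inr X :: Sum.inl a :: ρ)) ∧
    ∀ P σ, N = (testCtx b (test b σ)).fill P → fft P σ := by
  have nil_step : ∀ {α F}, ¬ Step .nil α F := by rintro α F ⟨⟩
  induction h with
  | done h =>
    refine ⟨?_, ?_, ?_⟩
    · rintro P rfl
      rcases step_testCtx.1 h with ⟨h, -⟩ | ⟨-, T', h, -⟩ | ⟨h, -⟩
      · simp at h
      · exact nil_step h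
      · cases h
    · rintro P X a ρ - rfl
      rcases step_testCtx.1 h with ⟨h, -⟩ | ⟨-, T', h, -⟩ | ⟨h, -⟩
      · simp at h
      · rcases step_refTest.1 h with ⟨h, -⟩ | ⟨n, -, h, -⟩
        · exact absurd (Act.act.inj h).symm (skip_ne b a)
        · exact absurd (Act.act.inj h).symm (skip_ne b n)
      · cases h
    · rintro P σ rfl
      rcases step_testCtx.1 h with ⟨h, -⟩ | ⟨-, T', h, -⟩ | ⟨h, -⟩
      · simp at h
      · rcases σ with _ | ⟨a | X, ρ⟩
        · exact .top
        · rw [test] at h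
          rcases step_actTest.1 h with ⟨h, -⟩ | ⟨h, -⟩
          · exact absurd (Act.act.inj h).symm (skip_ne b a)
          · cases h
        · obtain ⟨E, hE⟩ := exists_test_ref b X ρ
          rw [hE] at h
          rcases step_refTest.1 h with ⟨h, -⟩ | ⟨n, -, h, -⟩
          · cases h
          · exact absurd (Act.act.inj h).symm (skip_ne b n)
      · cases h
  | tau h _ ih =>
    obtain ⟨ih1, ih2, ih3⟩ := ih
    refine ⟨?_, ?_, ?_⟩
    · rintro P rfl
      rcases step_testCtx.1 h with ⟨-, P', h, h'⟩ | ⟨-, T', h, -⟩ | ⟨-, a, P', T', h, h', -⟩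
      · exact ih1 _ h'
      · exact nil_step h
      · exact nil_step h'
    · rintro P X a ρ ha rfl
      rcases step_testCtx.1 h with ⟨-, P', h, hN⟩ | ⟨-, T', h, -⟩ | ⟨-, c, P', T', h, h', hN⟩
      · exact (ih2 _ _ _ _ ha hN).imp (.tau h) (.tau h)
      · exact absurd ⟨_, h⟩ (stable_refTest (by simp))
      · rcases step_refTest.1 h' with ⟨hl, rfl⟩ | ⟨n, -, -, rfl⟩
        · cases skip_injective b (Act.act.inj hl)
          exact .inl (.act h (ih3 _ _ hN))
        · exact absurd hN (ih1 _)
    · rintro P σ rfl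
      rcases step_testCtx.1 h with ⟨-, P', h, hN⟩ | ⟨-, T', h, hN⟩ | ⟨-, c, P', T', h, h', hN⟩
      · exact .tau h (ih3 _ _ hN)
      · rcases σ with _ | ⟨a | X, ρ⟩
        · exact .top
        · rw [test] at h
          rcases step_actTest.1 h with ⟨h, -⟩ | ⟨-, rfl⟩
          · cases h
          · exact absurd hN (ih1 _)
        · obtain ⟨E, hE⟩ := exists_test_ref b X ρ
          rw [hE] at h
          exact absurd ⟨_, h⟩ (stable_refTest (by simp))
      · rcases σ with _ | ⟨a | X, ρ⟩
        · exact .top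
        · rw [test] at h'
          rcases step_actTest.1 h' with ⟨hl, rfl⟩ | ⟨-, rfl⟩
          · cases skip_injective b (Act.act.inj hl)
            exact .act ‹Step P _ _› (ih3 _ _ hN)
          · exact absurd hN (ih1 _)
        · obtain ⟨E, hE⟩ := exists_test_ref b X ρ
          rw [hE] at h'
          rcases step_refTest.1 h' with ⟨h', -⟩ | ⟨n, -, -, rfl⟩
          · cases h'
          · exact absurd hN (ih1 _)
  | timeout hs h _ ih =>
    obtain ⟨ih1, ih2, ih3⟩ := ih
    refine ⟨?_, ?_, ?_⟩
    · rintro P rfl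
      rcases step_testCtx.1 h with ⟨-, P', h, h'⟩ | ⟨-, T', h, -⟩ | ⟨h, -⟩
      · exact ih1 _ h'
      · exact nil_step h
      · cases h
    · rintro P X a ρ ha rfl
      obtain ⟨h1, h2⟩ := (stable_testCtx_refTest (by simp)
        fun c hc => ⟨a, ha, (Act.act.inj hc).symm⟩).1 hs
      rcases step_testCtx.1 h with ⟨-, P', h, hN⟩ | ⟨-, T', h, -⟩ | ⟨h, -⟩
      · exact .inr ((ih2 _ _ _ _ ha hN).elim (fun h' => .timeoutAct h2 h1 h h' ha)
          (.timeoutRef h2 h1 h))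
      · rcases step_refTest.1 h with ⟨h, -⟩ | ⟨n, -, h, -⟩ <;> cases h
      · cases h
    · rintro P σ rfl
      rcases σ with _ | ⟨a | X, ρ⟩
      · exact .top
      · rw [test] at hs
        exact absurd ⟨_, step_actTest.2 (.inr ⟨rfl, rfl⟩)⟩ (stable_testCtx.1 hs).2.1
      · obtain ⟨h1, h2⟩ : stable P ∧ ∀ a ∈ X, a ∉ initials P := by
          obtain ⟨E, hE⟩ := exists_test_ref b X ρ
          rw [hE] at hs
          exact (stable_testCtx_refTest (by simp) (by simp)).1 hs
        rcases step_testCtx.1 h with ⟨-, P', h, hN⟩ | ⟨-, T', h, hN⟩ | ⟨h, -⟩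
        · exact .timeoutRef h2 h1 h (ih3 _ _ hN)
        · rcases mem_or_notHead X ρ with ⟨a, ha, ρ', rfl⟩ | hn
          · rw [test_ref_of_mem ha] at h
            rcases step_refTest.1 h with ⟨-, rfl⟩ | ⟨n, -, h, -⟩
            · exact (ih2 _ _ _ _ ha hN).elim (.refusal h2 h1) id
            · cases h
          · rw [test_ref_of_notHead hn] at h
            rcases step_refTest.1 h with ⟨-, rfl⟩ | ⟨n, -, h, -⟩
            · exact .refusal h2 h1 (ih3 _ _ hN)
            · cases h
        · cases h

/-- Fix an action `b ∈ A`.  The partial failure trace preorder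
is fully abstract w.r.t. the operators of CCSP^g_t and the canonical safety
property: `fft(P) ⊇ fft(Q)` iff for every unary recursion-free CCSP^g_t-context
`C`, `C[P] ⊨ safety(b)` implies `C[Q] ⊨ safety(b)`. -/
theorem fft_fully_abstract_safety (b : ℕ) (P Q : Expr)
    (hP : IsProcess P) (hQ : IsProcess Q) :
    fftSet Q ⊆ fftSet P ↔
      ∀ C : GCtx, GCtx.OK C → (Safety b (C.fill P) → Safety b (C.fill Q)) := by
  constructor
  · intro h C _ hs σ hσ
    exact hs σ (C.fftSet_fill_mono h hσ)
  · intro h σ hσ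
    by_contra hn
    have hs := h _ (testCtx_ok b σ)
    rw [safety_testCtx_iff, safety_testCtx_iff] at hs
    exact hs (fun hw => hn ((fft_of_win_aux hw).2.2 P σ rfl)) (win_of_fft hσ)
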